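/- arXiv:1905.04518 — 7 statements merged into one kernel-verified Lean document; each statement's English description precedes it below -/
import Mathlib

section
/- Let (g, [·,·,·]) be a 3-Lie superalgebra over a field K and let α, β : g → g be two commuting even morphisms of the 3-Lie superalgebra structure (i.e. α∘β = β∘α and both α and β preserve the trilinear bracket). Define a new trilinear bracket by [x,y,z]_{α,β} = [α(x), α(y), β(z)]. Then (g, [·,·,·]_{α,β}, α, β) is a 3-BiHom-Lie superalgebra. -/
namespace BiHomLieSuper

/-- The sign `(-1)^n` for a parity `n : ZMod 2`. -/
def sg (K : Type*) [Field K] (n : ZMod 2) : K := if n = 0 then 1 else -1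

variable (K : Type*) {V : Type*} [Field K] [AddCommGroup V] [Module K V]

/-- `f : V → V → V` is bilinear. -/
structure IsBilinear (f : V → V → V) : Prop where
  add_left : ∀ x x' y : V, f (x + x') y = f x y + f x' y
  smul_left : ∀ (c : K) (x y : V), f (c • x) y = c • f x y
  add_right : ∀ x y y' : V, f x (y + y') = f x y + f x y'
  smul_right : ∀ (c : K) (x y : V), f x (c • y) = c • f x y

/-- `f : V → V → V → V` is trilinear. -/
structure IsTrilinear (f : V → V → V → V) : Prop where
  add₁ : ∀ x x' y z : V, f (x + x') y z = f x y z + f x' y z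
  smul₁ : ∀ (c : K) (x y z : V), f (c • x) y z = c • f x y z
  add₂ : ∀ x y y' z : V, f x (y + y') z = f x y z + f x y' z
  smul₂ : ∀ (c : K) (x y z : V), f x (c • y) z = c • f x y z
  add₃ : ∀ x y z z' : V, f x y (z + z') = f x y z + f x y z'
  smul₃ : ∀ (c : K) (x y z : V), f x y (c • z) = c • f x y z

/-- An even linear map preserves the `ZMod 2`-grading. -/
def IsEvenMap (G : ZMod 2 → Submodule K V) (φ : Module.End K V) : Prop :=
  ∀ (i : ZMod 2), ∀ x ∈ G i, φ x ∈ G i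

/-- A homogeneous linear map of degree `d` with respect to the grading `G`. -/
def IsHomogeneousMap (G : ZMod 2 → Submodule K V) (d : ZMod 2) (D : Module.End K V) : Prop :=
  ∀ (i : ZMod 2), ∀ x ∈ G i, D x ∈ G (i + d)

/-- A nonmultiplicative BiHom-Lie superalgebra structure on the `ZMod 2`-graded
vector space `V` (grading `G`), with bracket `br` and structure maps `α`, `β`. -/
structure IsNonMultBiHomLieSuperalgebra (G : ZMod 2 → Submodule K V)
    (br : V → V → V) (α β : Module.End K V) : Prop where
  internal : DirectSum.IsInternal G
  bilinear : IsBilinear K br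
  br_even : ∀ (i j : ZMod 2), ∀ x ∈ G i, ∀ y ∈ G j, br x y ∈ G (i + j)
  alpha_even : IsEvenMap K G α
  beta_even : IsEvenMap K G β
  skew : ∀ (i j : ZMod 2), ∀ x ∈ G i, ∀ y ∈ G j,
    br (β x) (α y) = - sg K (i * j) • br (β y) (α x)
  jacobi : ∀ (i j k : ZMod 2), ∀ x ∈ G i, ∀ y ∈ G j, ∀ z ∈ G k,
    sg K (i * k) • br (β (β x)) (br (β y) (α z))
      + sg K (j * i) • br (β (β y)) (br (β z) (α x))
      + sg K (k * j) • br (β (β z)) (br (β x) (α y)) = 0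

/-- A (multiplicative) BiHom-Lie superalgebra. -/
structure IsBiHomLieSuperalgebra (G : ZMod 2 → Submodule K V)
    (br : V → V → V) (α β : Module.End K V)
    extends IsNonMultBiHomLieSuperalgebra K G br α β : Prop where
  comm : α * β = β * α
  alpha_br : ∀ x y : V, α (br x y) = br (α x) (α y)
  beta_br : ∀ x y : V, β (br x y) = br (β x) (β y)

/-- A nonmultiplicative 3-BiHom-Lie superalgebra structure. -/
structure IsNonMult3BiHomLieSuperalgebra (G : ZMod 2 → Submodule K V)
    (br : V → V → V → V) (α β : Module.End K V) : Prop where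
  internal : DirectSum.IsInternal G
  trilinear : IsTrilinear K br
  br_even : ∀ (i j k : ZMod 2), ∀ x ∈ G i, ∀ y ∈ G j, ∀ z ∈ G k, br x y z ∈ G (i + j + k)
  alpha_even : IsEvenMap K G α
  beta_even : IsEvenMap K G β
  skew₁ : ∀ (i j k : ZMod 2), ∀ x ∈ G i, ∀ y ∈ G j, ∀ z ∈ G k,
    br (β x) (β y) (α z) = - sg K (i * j) • br (β y) (β x) (α z)
  skew₂ : ∀ (i j k : ZMod 2), ∀ x ∈ G i, ∀ y ∈ G j, ∀ z ∈ G k,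
    br (β x) (β y) (α z) = - sg K (j * k) • br (β x) (β z) (α y)
  jacobi : ∀ (i j k l m : ZMod 2), ∀ x ∈ G i, ∀ y ∈ G j, ∀ z ∈ G k, ∀ u ∈ G l, ∀ v ∈ G m,
    br (β (β x)) (β (β y)) (br (β z) (β u) (α v))
      = sg K ((l + m) * (i + j + k)) • br (β (β u)) (β (β v)) (br (β x) (β y) (α z))
        - sg K ((k + m) * (i + j) + l * m) • br (β (β z)) (β (β v)) (br (β x) (β y) (α u))
        + sg K ((k + l) * (i + j)) • br (β (β z)) (β (β u)) (br (β x) (β y) (α v))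

/-- A (multiplicative) 3-BiHom-Lie superalgebra. -/
structure Is3BiHomLieSuperalgebra (G : ZMod 2 → Submodule K V)
    (br : V → V → V → V) (α β : Module.End K V)
    extends IsNonMult3BiHomLieSuperalgebra K G br α β : Prop where
  comm : α * β = β * α
  alpha_br : ∀ x y z : V, α (br x y z) = br (α x) (α y) (α z)
  beta_br : ∀ x y z : V, β (br x y z) = br (β x) (β y) (β z)

/-- A 3-Lie superalgebra structure (no structure maps). -/
structure Is3LieSuperalgebra (G : ZMod 2 → Submodule K V)
    (br : V → V → V → V) : Prop where
  internal : DirectSum.IsInternal G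
  trilinear : IsTrilinear K br
  br_even : ∀ (i j k : ZMod 2), ∀ x ∈ G i, ∀ y ∈ G j, ∀ z ∈ G k, br x y z ∈ G (i + j + k)
  skew₁ : ∀ (i j k : ZMod 2), ∀ x ∈ G i, ∀ y ∈ G j, ∀ z ∈ G k,
    br x y z = - sg K (i * j) • br y x z
  skew₂ : ∀ (i j k : ZMod 2), ∀ x ∈ G i, ∀ y ∈ G j, ∀ z ∈ G k,
    br x y z = - sg K (j * k) • br x z y
  jacobi : ∀ (i j k l m : ZMod 2), ∀ x ∈ G i, ∀ y ∈ G j, ∀ z ∈ G k, ∀ u ∈ G l, ∀ v ∈ G m,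
    br x y (br z u v) = br (br x y z) u v + sg K (k * (i + j)) • br z (br x y u) v
      + sg K ((k + l) * (i + j)) • br z u (br x y v)

/-- The compatibility conditions on the even linear form `τ` used to induce a
ternary bracket from a binary one: `τ` vanishes on the odd part, `τ([x,y]) = 0`,
`τ(x)τ(β(y)) = τ(y)τ(β(x))` and `τ(α(x))β(y) = τ(β(x))α(y)`. -/
def TauCompatible (G : ZMod 2 → Submodule K V) (br : V → V → V)
    (α β : Module.End K V) (τ : V →ₗ[K] K) : Prop :=
  (∀ x ∈ G 1, τ x = 0) ∧ (∀ x y : V, τ (br x y) = 0) ∧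
  (∀ x y : V, τ x * τ (β y) = τ y * τ (β x)) ∧
  (∀ x y : V, τ (α x) • β y = τ (β x) • α y)

/-- `brτ` is the trilinear bracket induced by `τ` from the binary bracket `br`:
on homogeneous elements it is given by
`[x,y,z]_τ = τ(x)[y,z] - (-1)^{|x||y|} τ(y)[x,z] + (-1)^{|z|(|x|+|y|)} τ(z)[x,y]`. -/
def IsInducedBracket (G : ZMod 2 → Submodule K V) (br : V → V → V)
    (τ : V →ₗ[K] K) (brτ : V → V → V → V) : Prop :=
  IsTrilinear K brτ ∧
  ∀ (i j k : ZMod 2), ∀ x ∈ G i, ∀ y ∈ G j, ∀ z ∈ G k,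
    brτ x y z = τ x • br y z - (sg K (i * j) * τ y) • br x z
      + (sg K (k * (i + j)) * τ z) • br x y

/-- The Rota-Baxter identity of weight `lam` for a binary bracket. -/
def IsRotaBaxter₂ (br : V → V → V) (lam : K) (R : Module.End K V) : Prop :=
  ∀ x y : V, br (R x) (R y) = R (br (R x) y + br x (R y) + lam • br x y)

/-- The Rota-Baxter identity of weight `lam` for a ternary bracket. -/
def IsRotaBaxter₃ (br : V → V → V → V) (lam : K) (R : Module.End K V) : Prop :=
  ∀ x y z : V,
    br (R x) (R y) (R z)
      = R (br (R x) (R y) z + br (R x) y (R z) + br x (R y) (R z)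
          + lam • br (R x) y z + lam • br x (R y) z + lam • br x y (R z)
          + lam ^ 2 • br x y z)

/-- The Nijenhuis identity for a binary bracket. -/
def IsNijenhuis₂ (br : V → V → V) (N : Module.End K V) : Prop :=
  ∀ x y : V, br (N x) (N y) = N (br (N x) y + br x (N y) - N (br x y))

/-- The Nijenhuis identity for a ternary bracket. -/
def IsNijenhuis₃ (br : V → V → V → V) (N : Module.End K V) : Prop :=
  ∀ x y z : V,
    br (N x) (N y) (N z)
      = N (br (N x) (N y) z + br (N x) y (N z) + br x (N y) (N z))
        - N (N (br (N x) y z + br x (N y) z + br x y (N z)))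
        + N (N (N (br x y z)))

/-- `D` is an `(α^s, β^r)`-derivation of degree `d` of the binary bracket `br`. -/
def IsAlphaBetaDeriv₂ (G : ZMod 2 → Submodule K V) (br : V → V → V)
    (α β : Module.End K V) (s r : ℕ) (d : ZMod 2) (D : Module.End K V) : Prop :=
  D * α = α * D ∧ D * β = β * D ∧
  ∀ (i j : ZMod 2), ∀ x ∈ G i, ∀ y ∈ G j,
    D (br x y) = br (D x) ((α ^ s * β ^ r) y)
      + sg K (i * d) • br ((α ^ s * β ^ r) x) (D y)

/-- `D` is an `(α^s, β^r)`-derivation of degree `d` of the ternary bracket `br`. -/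
def IsAlphaBetaDeriv₃ (G : ZMod 2 → Submodule K V) (br : V → V → V → V)
    (α β : Module.End K V) (s r : ℕ) (d : ZMod 2) (D : Module.End K V) : Prop :=
  D * α = α * D ∧ D * β = β * D ∧
  ∀ (i j k : ZMod 2), ∀ x ∈ G i, ∀ y ∈ G j, ∀ z ∈ G k,
    D (br x y z) = br (D x) ((α ^ s * β ^ r) y) ((α ^ s * β ^ r) z)
      + sg K (i * d) • br ((α ^ s * β ^ r) x) (D y) ((α ^ s * β ^ r) z)
      + sg K (d * (i + j)) • br ((α ^ s * β ^ r) x) ((α ^ s * β ^ r) y) (D z)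

/-- An even super-skewsymmetric trilinear map with respect to the grading `G`
and the structure maps `α`, `β`. -/
structure IsEvenSkewTrilinear (G : ZMod 2 → Submodule K V)
    (α β : Module.End K V) (f : V → V → V → V) : Prop where
  trilinear : IsTrilinear K f
  even : ∀ (i j k : ZMod 2), ∀ x ∈ G i, ∀ y ∈ G j, ∀ z ∈ G k, f x y z ∈ G (i + j + k)
  skew₁ : ∀ (i j k : ZMod 2), ∀ x ∈ G i, ∀ y ∈ G j, ∀ z ∈ G k,
    f (β x) (β y) (α z) = - sg K (i * j) • f (β y) (β x) (α z)
  skew₂ : ∀ (i j k : ZMod 2), ∀ x ∈ G i, ∀ y ∈ G j, ∀ z ∈ G k,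
    f (β x) (β y) (α z) = - sg K (j * k) • f (β x) (β z) (α y)

/-- The composition `(f ∘_{α,β} g)(x₁∧x₂, y₁∧y₂, z)` of two trilinear maps,
for homogeneous `x₁, x₂, y₁, y₂` of degrees `a, b, c, d`. -/
def circ (α β : Module.End K V) (f g : V → V → V → V)
    (a b c d : ZMod 2) (x₁ x₂ y₁ y₂ z : V) : V :=
  f (g (β x₁) (β x₂) (α y₁)) (β (β y₂)) (β (β z))
    + sg K (c * (a + b)) • f (β (β y₁)) (g (β x₁) (β x₂) (α y₂)) (β (β z))
    - f (β (β x₁)) (β (β x₂)) (g (β y₁) (β y₂) (α z))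
    + sg K ((a + b) * (c + d)) • f (β (β y₁)) (β (β y₂)) (g (β x₁) (β x₂) (α z))


theorem sg_add (K : Type*) [Field K] (a b : ZMod 2) : sg K (a + b) = sg K a * sg K b := by
  have zero_or_one : ∀ c : ZMod 2, c = 0 ∨ c = 1 := by decide
  have one_add_one : (1 : ZMod 2) + 1 = 0 := by decide
  rcases zero_or_one a with rfl | rfl <;> rcases zero_or_one b with rfl | rfl <;>
    simp [sg, one_add_one]

/-- In a 3-Lie superalgebra the fundamental identity can be written with every inner bracket in
the last slot. -/
theorem Is3LieSuperalgebra.jacobi_last {K V : Type*} [Field K] [AddCommGroup V] [Module K V]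
    {G : ZMod 2 → Submodule K V} {br : V → V → V → V} (h : Is3LieSuperalgebra K G br)
    {i j k l m : ZMod 2} {x y z u v : V}
    (hx : x ∈ G i) (hy : y ∈ G j) (hz : z ∈ G k) (hu : u ∈ G l) (hv : v ∈ G m) :
    br x y (br z u v)
      = sg K ((l + m) * (i + j + k)) • br u v (br x y z)
        - sg K ((k + m) * (i + j) + l * m) • br z v (br x y u)
        + sg K ((k + l) * (i + j)) • br z u (br x y v) := by
  have sign_xyz : (l + m) * (i + j + k) = (i + j + k) * l + (i + j + k) * m := by ring
  have sign_xyu : (k + m) * (i + j) + l * m = k * (i + j) + (i + j + l) * m := by ring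
  have hxyz := h.br_even i j k x hx y hy z hz
  have hxyu := h.br_even i j l x hx y hy u hu
  rw [h.jacobi i j k l m x hx y hy z hz u hu v hv,
    h.skew₁ _ _ _ _ hxyz u hu v hv, h.skew₂ _ _ _ u hu _ hxyz v hv,
    h.skew₂ _ _ _ z hz _ hxyu v hv, smul_smul, smul_smul, neg_mul_neg, mul_neg, neg_smul,
    ← sg_add, ← sg_add, ← sub_eq_add_neg, sign_xyz, sign_xyu]

/-- A 3-Lie superalgebra twisted by two commuting even morphisms `α`, `β`
via `[x,y,z]_{α,β} = [α(x), α(y), β(z)]` is a 3-BiHom-Lie superalgebra. -/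
theorem threeBiHom_of_threeLie_twist {K V : Type*} [Field K] [AddCommGroup V] [Module K V]
    (G : ZMod 2 → Submodule K V)
    (br : V → V → V → V) (α β : Module.End K V)
    (h : Is3LieSuperalgebra K G br)
    (hαe : IsEvenMap K G α) (hβe : IsEvenMap K G β)
    (hcomm : α * β = β * α)
    (hα : ∀ x y z : V, α (br x y z) = br (α x) (α y) (α z))
    (hβ : ∀ x y z : V, β (br x y z) = br (β x) (β y) (β z)) :
    Is3BiHomLieSuperalgebra K G (fun x y z => br (α x) (α y) (β z)) α β := by
  have hc (x : V) : β (α x) = α (β x) := (LinearMap.congr_fun hcomm x).symm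
  refine ⟨⟨h.internal, ?_, ?_, hαe, hβe, ?_, ?_, ?_⟩, hcomm, ?_, ?_⟩
  · constructor <;> intros <;> simp only [map_add, map_smul, h.trilinear.add₁,
      h.trilinear.smul₁, h.trilinear.add₂, h.trilinear.smul₂, h.trilinear.add₃, h.trilinear.smul₃]
  · intro i j k x hx y hy z hz
    exact h.br_even i j k _ (hαe i x hx) _ (hαe j y hy) _ (hβe k z hz)
  · intro i j k x hx y hy z hz
    exact h.skew₁ i j k _ (hαe i _ (hβe i x hx)) _ (hαe j _ (hβe j y hy))
      _ (hβe k _ (hαe k z hz))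
  · intro i j k x hx y hy z hz
    simp only [hc]
    exact h.skew₂ i j k _ (hαe i _ (hβe i x hx)) _ (hαe j _ (hβe j y hy))
      _ (hαe k _ (hβe k z hz))
  · intro i j k l m x hx y hy z hz u hu v hv
    have mem {n : ZMod 2} {w : V} (hw : w ∈ G n) : α (β (β w)) ∈ G n :=
      hαe n _ (hβe n _ (hβe n w hw))
    simp only [hβ, hc]
    exact h.jacobi_last (mem hx) (mem hy) (mem hz) (mem hu) (mem hv)
  · intro x y z
    simp only [hα, hc]
  · intro x y z
    simp only [hβ, hc]

end BiHomLieSuper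
end

section
/- Let (g, [·,·], α, β) be a nonmultiplicative BiHom-Lie superalgebra over a field K and let τ : g → K be an even linear form (so τ vanishes on g₁) satisfying, for all x, y ∈ g: τ([x,y]) = 0, τ(x)τ(β(y)) = τ(y)τ(β(x)), and τ(α(x))β(y) = τ(β(x))α(y). Then (g, [·,·,·]_τ, α, β), with [x₁,x₂,x₃]_τ = τ(x₁)[x₂,x₃] - (-1)^{|x₁||x₂|}τ(x₂)[x₁,x₃] + (-1)^{|x₃|(|x₁|+|x₂|)}τ(x₃)[x₁,x₂] on homogeneous elements, is a nonmultiplicative 3-BiHom-Lie superalgebra. -/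
namespace BiHomLieSuper

variable (K : Type*) {V : Type*} [Field K] [AddCommGroup V] [Module K V]

variable {K}

theorem parity_cases (i : ZMod 2) : i = 0 ∨ i = 1 := by
  revert i; decide

@[simp] theorem sg_zero : sg K 0 = 1 := if_pos rfl

@[simp] theorem sg_one : sg K 1 = -1 := if_neg (by decide)

theorem IsBilinear.neg_right {br : V → V → V} (hb : IsBilinear K br) (x y : V) :
    br x (-y) = -br x y := by
  simpa using hb.smul_right (-1) x y

theorem IsBilinear.sub_right {br : V → V → V} (hb : IsBilinear K br) (x y z : V) :
    br x (y - z) = br x y - br x z := by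
  rw [sub_eq_add_neg, hb.add_right, hb.neg_right, ← sub_eq_add_neg]

/-- The BiHom-super-Jacobi identity in Leibniz form. -/
theorem IsNonMultBiHomLieSuperalgebra.leibniz {G : ZMod 2 → Submodule K V} {br : V → V → V}
    {α β : Module.End K V} (h : IsNonMultBiHomLieSuperalgebra K G br α β) {i j k : ZMod 2}
    {x y z : V} (hx : x ∈ G i) (hy : y ∈ G j) (hz : z ∈ G k) :
    br (β (β x)) (br (β y) (α z))
      = sg K (i * j) • br (β (β y)) (br (β x) (α z))
        - sg K (k * (i + j)) • br (β (β z)) (br (β x) (α y)) := by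
  have hJ := h.jacobi i j k x hx y hy z hz
  rw [h.skew k i z hz x hx, h.bilinear.smul_right] at hJ
  have two : (1 + 1 : ZMod 2) = 0 := by decide
  rcases parity_cases i with rfl | rfl <;> rcases parity_cases j with rfl | rfl <;>
    rcases parity_cases k with rfl | rfl <;>
    simp only [mul_zero, mul_one, add_zero, zero_add, two, sg_zero, sg_one] at hJ ⊢ <;>
    first
    | linear_combination (norm := module) (1 : K) • hJ
    | linear_combination (norm := module) (-1 : K) • hJ

/-- A linear form `τ` with `τ(x)τ(β(y)) = τ(y)τ(β(x))` is an eigenvector of the transpose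
of `β`. -/
theorem exists_apply_eq_mul (τ : V →ₗ[K] K) (β : Module.End K V)
    (hβ : ∀ x y : V, τ x * τ (β y) = τ y * τ (β x)) : ∃ c : K, ∀ x, τ (β x) = c * τ x := by
  by_cases hτ : ∀ x, τ x = 0
  · exact ⟨0, fun x => by simp [hτ]⟩
  · push Not at hτ
    obtain ⟨w, hw⟩ := hτ
    refine ⟨τ (β w) / τ w, fun x => ?_⟩
    field_simp
    linear_combination hβ w x

theorem TauCompatible.smul_br {G : ZMod 2 → Submodule K V} {br : V → V → V}
    {α β : Module.End K V} {τ : V →ₗ[K] K} (hτ : TauCompatible K G br α β τ)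
    (hb : IsBilinear K br) (x y z : V) : τ (α z) • br x (β y) = τ (β z) • br x (α y) := by
  rw [← hb.smul_right, hτ.2.2.2, hb.smul_right]

/-- The ternary bracket induced by a compatible even linear form `τ` on a
nonmultiplicative BiHom-Lie superalgebra yields a nonmultiplicative
3-BiHom-Lie superalgebra. -/
theorem induced_threeBiHom {K V : Type*} [Field K] [AddCommGroup V] [Module K V]
    (G : ZMod 2 → Submodule K V)
    (br : V → V → V) (α β : Module.End K V)
    (h : IsNonMultBiHomLieSuperalgebra K G br α β)
    (τ : V →ₗ[K] K) (hτ : TauCompatible K G br α β τ)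
    (brτ : V → V → V → V) (hind : IsInducedBracket K G br τ brτ) :
    IsNonMult3BiHomLieSuperalgebra K G brτ α β := by
  have two : (1 + 1 : ZMod 2) = 0 := by decide
  have odd : ∀ x ∈ G 1, τ x = 0 := hτ.1
  have hb := h.bilinear
  obtain ⟨c, hc⟩ := exists_apply_eq_mul τ β hτ.2.2.1
  have even : ∀ (i j k : ZMod 2), ∀ x ∈ G i, ∀ y ∈ G j, ∀ z ∈ G k,
      brτ x y z ∈ G (i + j + k) := by
    intro i j k x hx y hy z hz
    rw [hind.2 i j k x hx y hy z hz]
    refine add_mem (sub_mem ?_ ?_) ?_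
    · rcases parity_cases i with rfl | rfl
      · simpa using Submodule.smul_mem _ _ (h.br_even j k y hy z hz)
      · simp [odd x hx]
    · rcases parity_cases j with rfl | rfl
      · simpa using Submodule.smul_mem _ _ (h.br_even i k x hx z hz)
      · simp [odd y hy]
    · rcases parity_cases k with rfl | rfl
      · simpa using Submodule.smul_mem _ _ (h.br_even i j x hx y hy)
      · simp [odd z hz]
  have inner : ∀ (i j k : ZMod 2), ∀ x ∈ G i, ∀ y ∈ G j, ∀ z ∈ G k,
      brτ (β x) (β y) (α z) = (c * τ x) • br (β y) (α z)
        - (sg K (i * j) * (c * τ y)) • br (β x) (α z)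
        + (sg K (k * (i + j)) * (c * τ z)) • br (β x) (α y) := by
    intro i j k x hx y hy z hz
    rw [hind.2 i j k _ (h.beta_even i x hx) _ (h.beta_even j y hy) _ (h.alpha_even k z hz),
      mul_smul (sg K (k * (i + j))), hτ.smul_br hb, ← mul_smul, hc, hc, hc]
  have outer : ∀ (i j k l m : ZMod 2), ∀ x ∈ G i, ∀ y ∈ G j, ∀ z ∈ G k, ∀ u ∈ G l, ∀ v ∈ G m,
      brτ (β (β x)) (β (β y)) (brτ (β z) (β u) (α v))
        = (c * (c * τ x)) • br (β (β y)) (brτ (β z) (β u) (α v))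
          - (sg K (i * j) * (c * (c * τ y))) • br (β (β x)) (brτ (β z) (β u) (α v)) := by
    intro i j k l m x hx y hy z hz u hu v hv
    have hW : τ (brτ (β z) (β u) (α v)) = 0 := by
      rw [inner k l m z hz u hu v hv]
      simp [hτ.2.1]
    rw [hind.2 i j _ _ (h.beta_even i _ (h.beta_even i x hx)) _
      (h.beta_even j _ (h.beta_even j y hy)) _
      (even k l m _ (h.beta_even k z hz) _ (h.beta_even l u hu) _ (h.alpha_even m v hv)),
      hW, hc, hc, hc, hc]
    simp
  refine ⟨h.internal, hind.1, even, h.alpha_even, h.beta_even, ?_, ?_, ?_⟩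
  · intro i j k x hx y hy z hz
    rw [inner i j k x hx y hy z hz, inner j i k y hy x hx z hz, h.skew i j x hx y hy]
    rcases parity_cases i with rfl | rfl <;> rcases parity_cases j with rfl | rfl <;>
      rcases parity_cases k with rfl | rfl <;>
      simp only [mul_zero, mul_one, one_mul, add_zero, zero_add, two, sg_zero,
        sg_one] <;>
      module
  · intro i j k x hx y hy z hz
    rw [inner i j k x hx y hy z hz, inner i k j x hx z hz y hy, h.skew j k y hy z hz]
    rcases parity_cases i with rfl | rfl <;> rcases parity_cases j with rfl | rfl <;>
      rcases parity_cases k with rfl | rfl <;>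
      simp only [mul_zero, mul_one, one_mul, add_zero, zero_add, two, sg_zero,
        sg_one] <;>
      module
  · intro i j k l m x hx y hy z hz u hu v hv
    rw [outer i j k l m x hx y hy z hz u hu v hv, outer l m i j k u hu v hv x hx y hy z hz,
      outer k m i j l z hz v hv x hx y hy u hu, outer k l i j m z hz u hu x hx y hy v hv,
      inner k l m z hz u hu v hv, inner i j k x hx y hy z hz, inner i j l x hx y hy u hu,
      inner i j m x hx y hy v hv]
    simp only [hb.add_right, hb.sub_right, hb.smul_right]
    have hyuv := h.leibniz hy hu hv
    have hxuv := h.leibniz hx hu hv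
    have hyzv := h.leibniz hy hz hv
    have hxzv := h.leibniz hx hz hv
    have hyzu := h.leibniz hy hz hu
    have hxzu := h.leibniz hx hz hu
    rcases parity_cases i with rfl | rfl <;> rcases parity_cases j with rfl | rfl <;>
      rcases parity_cases k with rfl | rfl <;> rcases parity_cases l with rfl | rfl <;>
      rcases parity_cases m with rfl | rfl <;>
      simp only [mul_zero, mul_one, one_mul, add_zero, zero_add, two, sg_zero,
        sg_one] at hyuv hxuv hyzv hxzv hyzu hxzu ⊢ <;>
      linear_combination (norm :=
          (try simp only [odd, hx, hy, hz, hu, hv, mul_zero, zero_mul, zero_smul]) <;> module)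
        (c ^ 3 * τ x * τ z) • hyuv - (c ^ 3 * τ y * τ z) • hxuv
        - (c ^ 3 * τ x * τ u) • hyzv + (c ^ 3 * τ y * τ u) • hxzv
        + (c ^ 3 * τ x * τ v) • hyzu - (c ^ 3 * τ y * τ v) • hxzu

end BiHomLieSuper
end

section
/- Let (g, [·,·,·], α, β) be a 3-BiHom-Lie superalgebra over a field K and let R : g → g be an even invertible linear map commuting with α and β. Then R is a Rota-Baxter operator of weight 0 on g (i.e. [R(x),R(y),R(z)] = R([R(x),R(y),z] + [R(x),y,R(z)] + [x,R(y),R(z)]) for all x,y,z) if and only if R⁻¹ is an even derivation of g, i.e. R⁻¹([x,y,z]) = [R⁻¹(x),y,z] + [x,R⁻¹(y),z] + [x,y,R⁻¹(z)] for all x,y,z. -/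
namespace BiHomLieSuper

variable (K : Type*) {V : Type*} [Field K] [AddCommGroup V] [Module K V]

/-- The inverse of an even map is even. -/
theorem isEvenMap_of_inverse {K V : Type*} [Field K] [AddCommGroup V] [Module K V]
    {G : ZMod 2 → Submodule K V} (hG : DirectSum.IsInternal G) {R S : Module.End K V}
    (hRS : R * S = 1) (hSR : S * R = 1) (hR : IsEvenMap K G R) : IsEvenMap K G S := by
  intro i x hx
  have hne : i ≠ i + 1 := by clear hx; revert i; decide
  have huniv : (Set.univ : Set (ZMod 2)) = {i, i + 1} := by
    ext j
    have : j = i ∨ j = i + 1 := by clear hne hx; revert i j; decide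
    simpa using this
  have hc : IsCompl (G i) (G (i + 1)) :=
    (DirectSum.isInternal_submodule_iff_isCompl G hne huniv).mp hG
  obtain ⟨a, ha, b, hb, hab⟩ :=
    Submodule.mem_sup.mp (hc.sup_eq_top ▸ Submodule.mem_top : S x ∈ G i ⊔ G (i + 1))
  have hx' : R a + R b = x := by
    rw [← map_add, hab]
    exact LinearMap.congr_fun hRS x
  have hRb : R b ∈ G i := by
    rw [eq_sub_of_add_eq' hx']
    exact (G i).sub_mem hx (hR i a ha)
  have hRb_zero : R b = 0 := Submodule.disjoint_def.mp hc.disjoint _ hRb (hR _ b hb)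
  have hb_zero : b = 0 := by
    simpa [hRb_zero] using (LinearMap.congr_fun hSR b).symm
  rwa [← hab, hb_zero, add_zero]

/-- An even invertible linear map `R` (with inverse `S`) commuting with `α`
and `β` on a 3-BiHom-Lie superalgebra is a Rota-Baxter operator of weight `0`
if and only if its inverse is an even derivation. -/
theorem rotaBaxter_iff_inverse_deriv {K V : Type*} [Field K] [AddCommGroup V] [Module K V]
    (G : ZMod 2 → Submodule K V)
    (br : V → V → V → V) (α β : Module.End K V)
    (h : Is3BiHomLieSuperalgebra K G br α β)
    (R S : Module.End K V) (hRS : R * S = 1) (hSR : S * R = 1)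
    (hRe : IsEvenMap K G R) (hRα : R * α = α * R) (hRβ : R * β = β * R) :
    (∀ x y z : V, br (R x) (R y) (R z)
        = R (br (R x) (R y) z + br (R x) y (R z) + br x (R y) (R z)))
      ↔ (IsEvenMap K G S ∧
          ∀ x y z : V, S (br x y z) = br (S x) y z + br x (S y) z + br x y (S z)) := by
  have hR (x : V) : R (S x) = x := LinearMap.congr_fun hRS x
  have hS (x : V) : S (R x) = x := LinearMap.congr_fun hSR x
  constructor
  · refine fun hRB => ⟨isEvenMap_of_inverse h.internal hRS hSR hRe, fun x y z => ?_⟩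
    have key := congrArg S (hRB (S x) (S y) (S z))
    simp only [hR, hS] at key
    rw [key]
    abel
  · rintro ⟨-, hD⟩ x y z
    have key := congrArg R (hD (R x) (R y) (R z))
    simp only [hR, hS] at key
    rw [key]
    congr 1
    abel

end BiHomLieSuper
end

section
/- Let (g, [·,·,·], α, β) be a 3-BiHom-Lie superalgebra over a field K and let R be a Rota-Baxter operator of weight λ on g. Define [x₁,x₂,x₃]_R = [R(x₁),R(x₂),x₃] + [R(x₁),x₂,R(x₃)] + [x₁,R(x₂),R(x₃)] + λ[R(x₁),x₂,x₃] + λ[x₁,R(x₂),x₃] + λ[x₁,x₂,R(x₃)] + λ²[x₁,x₂,x₃]. Then (g, [·,·,·]_R, α, β) is a 3-BiHom-Lie superalgebra, and R is a Rota-Baxter operator of weight λ on (g, [·,·,·]_R, α, β). -/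
namespace BiHomLieSuper

variable (K : Type*) {V : Type*} [Field K] [AddCommGroup V] [Module K V]

section RotaBaxterDeformation

variable {K : Type*} {V : Type*} [Field K] [AddCommGroup V] [Module K V]

/-- The bracket `[·,·,·]_R` of weight `lam` obtained from a ternary bracket and an operator `R`. -/
def deformedBracket (br : V → V → V → V) (lam : K) (R : Module.End K V) (x y z : V) : V :=
  br (R x) (R y) z + br (R x) y (R z) + br x (R y) (R z)
    + lam • br (R x) y z + lam • br x (R y) z + lam • br x y (R z)
    + lam ^ 2 • br x y z

/-- The sum of `lam ^ (4 - n) • F` over all ways of applying `R` to `n ≤ 4` of the five arguments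
of `F`. -/
def deformedQuinary (F : V → V → V → V → V → V) (lam : K) (R : Module.End K V)
    (x y z u v : V) : V :=
  F x (R y) (R z) (R u) (R v) + F (R x) y (R z) (R u) (R v) + F (R x) (R y) z (R u) (R v)
    + F (R x) (R y) (R z) u (R v) + F (R x) (R y) (R z) (R u) v
    + lam • F x y (R z) (R u) (R v) + lam • F x (R y) z (R u) (R v)
    + lam • F x (R y) (R z) u (R v) + lam • F x (R y) (R z) (R u) v
    + lam • F (R x) y z (R u) (R v) + lam • F (R x) y (R z) u (R v)
    + lam • F (R x) y (R z) (R u) v + lam • F (R x) (R y) z u (R v)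
    + lam • F (R x) (R y) z (R u) v + lam • F (R x) (R y) (R z) u v
    + lam ^ 2 • F x y z (R u) (R v) + lam ^ 2 • F x y (R z) u (R v)
    + lam ^ 2 • F x y (R z) (R u) v + lam ^ 2 • F x (R y) z u (R v)
    + lam ^ 2 • F x (R y) z (R u) v + lam ^ 2 • F x (R y) (R z) u v
    + lam ^ 2 • F (R x) y z u (R v) + lam ^ 2 • F (R x) y z (R u) v
    + lam ^ 2 • F (R x) y (R z) u v + lam ^ 2 • F (R x) (R y) z u v
    + lam ^ 3 • F x y z u (R v) + lam ^ 3 • F x y z (R u) v + lam ^ 3 • F x y (R z) u v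
    + lam ^ 3 • F x (R y) z u v + lam ^ 3 • F (R x) y z u v + lam ^ 4 • F x y z u v

variable {br : V → V → V → V} {lam : K} {R : Module.End K V}

theorem IsTrilinear.deformedBracket (h : IsTrilinear K br) :
    IsTrilinear K (deformedBracket br lam R) := by
  constructor <;> intros <;>
    simp only [BiHomLieSuper.deformedBracket, map_add, map_smul,
      h.add₁, h.add₂, h.add₃, h.smul₁, h.smul₂, h.smul₃] <;>
    module

/-- A nested pair of deformed brackets treats its five arguments symmetrically. -/
theorem deformedBracket_deformedBracket (h : IsTrilinear K br) (hRB : IsRotaBaxter₃ K br lam R)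
    (x y z u v : V) :
    deformedBracket br lam R x y (deformedBracket br lam R z u v)
      = deformedQuinary (fun x y z u v => br x y (br z u v)) lam R x y z u v := by
  have hR : R (deformedBracket br lam R z u v) = br (R z) (R u) (R v) := (hRB z u v).symm
  rw [deformedBracket, hR]
  simp only [deformedBracket, deformedQuinary, h.add₃, h.smul₃]
  module

theorem IsRotaBaxter₃.deformedBracket (hRB : IsRotaBaxter₃ K br lam R) :
    IsRotaBaxter₃ K (deformedBracket br lam R) lam R := by
  have hR (x y z : V) :
      R (BiHomLieSuper.deformedBracket br lam R x y z) = br (R x) (R y) (R z) :=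
    (hRB x y z).symm
  intro x y z
  simp only [map_add, map_smul, hR]
  rfl

variable {G : ZMod 2 → Submodule K V} {α β : Module.End K V}

theorem Is3BiHomLieSuperalgebra.deformedBracket (h : Is3BiHomLieSuperalgebra K G br α β)
    (hRe : IsEvenMap K G R) (hRα : R * α = α * R) (hRβ : R * β = β * R)
    (hRB : IsRotaBaxter₃ K br lam R) :
    Is3BiHomLieSuperalgebra K G (deformedBracket br lam R) α β := by
  have hα (x : V) : R (α x) = α (R x) := LinearMap.congr_fun hRα x
  have hβ (x : V) : R (β x) = β (R x) := LinearMap.congr_fun hRβ x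
  refine
    { internal := h.internal
      trilinear := h.trilinear.deformedBracket
      br_even := ?_
      alpha_even := h.alpha_even
      beta_even := h.beta_even
      skew₁ := ?_
      skew₂ := ?_
      jacobi := ?_
      comm := h.comm
      alpha_br := ?_
      beta_br := ?_ }
  · intro i j k x hx y hy z hz
    have E {x y z : V} (hx : x ∈ G i) (hy : y ∈ G j) (hz : z ∈ G k) :=
      h.br_even i j k x hx y hy z hz
    have hx' := hRe i x hx
    have hy' := hRe j y hy
    have hz' := hRe k z hz
    exact add_mem (add_mem (add_mem (add_mem (add_mem (add_mem (E hx' hy' hz) (E hx' hy hz'))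
      (E hx hy' hz')) (Submodule.smul_mem _ _ (E hx' hy hz)))
      (Submodule.smul_mem _ _ (E hx hy' hz))) (Submodule.smul_mem _ _ (E hx hy hz')))
      (Submodule.smul_mem _ _ (E hx hy hz))
  · intro i j k x hx y hy z hz
    have S {x y z : V} (hx : x ∈ G i) (hy : y ∈ G j) (hz : z ∈ G k) :=
      h.skew₁ i j k x hx y hy z hz
    have hx' := hRe i x hx
    have hy' := hRe j y hy
    have hz' := hRe k z hz
    simp only [BiHomLieSuper.deformedBracket, hα, hβ]
    linear_combination (norm := module)
      S hx' hy' hz + S hx' hy hz' + S hx hy' hz' + lam • S hx' hy hz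
      + lam • S hx hy' hz + lam • S hx hy hz' + lam ^ 2 • S hx hy hz
  · intro i j k x hx y hy z hz
    have S {x y z : V} (hx : x ∈ G i) (hy : y ∈ G j) (hz : z ∈ G k) :=
      h.skew₂ i j k x hx y hy z hz
    have hx' := hRe i x hx
    have hy' := hRe j y hy
    have hz' := hRe k z hz
    simp only [BiHomLieSuper.deformedBracket, hα, hβ]
    linear_combination (norm := module)
      S hx' hy' hz + S hx' hy hz' + S hx hy' hz' + lam • S hx' hy hz
      + lam • S hx hy' hz + lam • S hx hy hz' + lam ^ 2 • S hx hy hz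
  · intro i j k l m x hx y hy z hz u hu v hv
    have J {x y z u v : V} (hx : x ∈ G i) (hy : y ∈ G j) (hz : z ∈ G k) (hu : u ∈ G l)
        (hv : v ∈ G m) := h.jacobi i j k l m x hx y hy z hz u hu v hv
    have hx' := hRe i x hx
    have hy' := hRe j y hy
    have hz' := hRe k z hz
    have hu' := hRe l u hu
    have hv' := hRe m v hv
    simp only [deformedBracket_deformedBracket h.trilinear hRB, deformedQuinary, hα, hβ]
    linear_combination (norm := module)
      J hx hy' hz' hu' hv' + J hx' hy hz' hu' hv' + J hx' hy' hz hu' hv'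
      + J hx' hy' hz' hu hv' + J hx' hy' hz' hu' hv + lam • J hx hy hz' hu' hv'
      + lam • J hx hy' hz hu' hv' + lam • J hx hy' hz' hu hv' + lam • J hx hy' hz' hu' hv
      + lam • J hx' hy hz hu' hv' + lam • J hx' hy hz' hu hv' + lam • J hx' hy hz' hu' hv
      + lam • J hx' hy' hz hu hv' + lam • J hx' hy' hz hu' hv + lam • J hx' hy' hz' hu hv
      + lam ^ 2 • J hx hy hz hu' hv' + lam ^ 2 • J hx hy hz' hu hv'
      + lam ^ 2 • J hx hy hz' hu' hv + lam ^ 2 • J hx hy' hz hu hv'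
      + lam ^ 2 • J hx hy' hz hu' hv + lam ^ 2 • J hx hy' hz' hu hv
      + lam ^ 2 • J hx' hy hz hu hv' + lam ^ 2 • J hx' hy hz hu' hv
      + lam ^ 2 • J hx' hy hz' hu hv + lam ^ 2 • J hx' hy' hz hu hv
      + lam ^ 3 • J hx hy hz hu hv' + lam ^ 3 • J hx hy hz hu' hv
      + lam ^ 3 • J hx hy hz' hu hv + lam ^ 3 • J hx hy' hz hu hv
      + lam ^ 3 • J hx' hy hz hu hv + lam ^ 4 • J hx hy hz hu hv
  · intro x y z
    simp only [BiHomLieSuper.deformedBracket, map_add, map_smul, h.alpha_br, hα]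
  · intro x y z
    simp only [BiHomLieSuper.deformedBracket, map_add, map_smul, h.beta_br, hβ]

end RotaBaxterDeformation

/-- Given a Rota-Baxter operator `R` of weight `lam` on a 3-BiHom-Lie
superalgebra, the bracket `[·,·,·]_R` yields a 3-BiHom-Lie superalgebra and
`R` is again a Rota-Baxter operator of weight `lam` on it. -/
theorem rotaBaxter_new_bracket {K V : Type*} [Field K] [AddCommGroup V] [Module K V]
    (G : ZMod 2 → Submodule K V)
    (br : V → V → V → V) (α β : Module.End K V)
    (h : Is3BiHomLieSuperalgebra K G br α β)
    (lam : K) (R : Module.End K V)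
    (hRe : IsEvenMap K G R) (hRα : R * α = α * R) (hRβ : R * β = β * R)
    (hRB : IsRotaBaxter₃ K br lam R) :
    Is3BiHomLieSuperalgebra K G
      (fun x y z => br (R x) (R y) z + br (R x) y (R z) + br x (R y) (R z)
        + lam • br (R x) y z + lam • br x (R y) z + lam • br x y (R z)
        + lam ^ 2 • br x y z)
      α β ∧
    IsRotaBaxter₃ K
      (fun x y z => br (R x) (R y) z + br (R x) y (R z) + br x (R y) (R z)
        + lam • br (R x) y z + lam • br x (R y) z + lam • br x y (R z)
        + lam ^ 2 • br x y z)
      lam R :=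
  ⟨h.deformedBracket hRe hRα hRβ hRB, hRB.deformedBracket⟩

end BiHomLieSuper
end

section
/- Let (g, [·,·,·], α, β) be a 3-BiHom-Lie superalgebra over a field K and let R be a Rota-Baxter operator of weight λ on g satisfying R² = R. Define [x₁,x₂,x₃]_R = [R(x₁),R(x₂),x₃] + [R(x₁),x₂,R(x₃)] + [x₁,R(x₂),R(x₃)] + λ[R(x₁),x₂,x₃] + λ[x₁,R(x₂),x₃] + λ[x₁,x₂,R(x₃)] + λ²[x₁,x₂,x₃]. Then (g, [·,·,·]_R, α∘R, β∘R) is a nonmultiplicative 3-BiHom-Lie superalgebra. -/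
namespace BiHomLieSuper

variable (K : Type*) {V : Type*} [Field K] [AddCommGroup V] [Module K V]

section Twist

variable {K} (br : V → V → V → V) (lam : K) (R : Module.End K V)

/-- The bracket `[·,·,·]_R` of weight `lam` attached to `br` and `R`. -/
def twistedBracket (x y z : V) : V :=
  br (R x) (R y) z + br (R x) y (R z) + br x (R y) (R z)
    + lam • br (R x) y z + lam • br x (R y) z + lam • br x y (R z) + lam ^ 2 • br x y z

variable {br lam R}

theorem IsTrilinear.twistedBracket (hbr : IsTrilinear K br) :
    IsTrilinear K (twistedBracket br lam R) := by
  constructor <;> intros <;>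
    simp only [BiHomLieSuper.twistedBracket, map_add, map_smul, hbr.add₁, hbr.add₂, hbr.add₃,
      hbr.smul₁, hbr.smul₂, hbr.smul₃] <;> module

theorem twistedBracket_mem {G : ZMod 2 → Submodule K V} (hR : IsEvenMap K G R)
    (hbr : ∀ i j k : ZMod 2, ∀ x ∈ G i, ∀ y ∈ G j, ∀ z ∈ G k, br x y z ∈ G (i + j + k))
    {i j k : ZMod 2} {x y z : V} (hx : x ∈ G i) (hy : y ∈ G j) (hz : z ∈ G k) :
    twistedBracket br lam R x y z ∈ G (i + j + k) := by
  have hx' := hR i x hx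
  have hy' := hR j y hy
  have hz' := hR k z hz
  unfold twistedBracket
  refine add_mem (add_mem (add_mem (add_mem (add_mem (add_mem ?_ ?_) ?_) ?_) ?_) ?_) ?_ <;>
    (try apply Submodule.smul_mem) <;> apply hbr <;> assumption

theorem twistedBracket_of_fixed {a b c : V} (ha : R a = a) (hb : R b = b) (hc : R c = c) :
    twistedBracket br lam R a b c = (3 + 3 * lam + lam ^ 2) • br a b c := by
  simp only [twistedBracket, ha, hb, hc]
  module

theorem twistedBracket_twistedBracket_of_fixed (hbr : IsTrilinear K br)
    (hRB : IsRotaBaxter₃ K br lam R) {p q a b c : V} (hp : R p = p) (hq : R q = q)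
    (ha : R a = a) (hb : R b = b) (hc : R c = c) :
    twistedBracket br lam R p q (twistedBracket br lam R a b c)
      = ((1 + lam) ^ 2 * (3 + 3 * lam + lam ^ 2) + (2 + lam)) • br p q (br a b c) := by
  have hR : R (twistedBracket br lam R a b c) = br a b c := by
    rw [twistedBracket, ← hRB, ha, hb, hc]
  rw [twistedBracket, hR, hp, hq, twistedBracket_of_fixed ha hb hc, hbr.smul₃]
  module

end Twist

/-- Given an idempotent Rota-Baxter operator `R` of weight `lam` on a
3-BiHom-Lie superalgebra, `(g, [·,·,·]_R, α∘R, β∘R)` is a nonmultiplicative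
3-BiHom-Lie superalgebra. -/
theorem rotaBaxter_idempotent_twist {K V : Type*} [Field K] [AddCommGroup V] [Module K V]
    (G : ZMod 2 → Submodule K V)
    (br : V → V → V → V) (α β : Module.End K V)
    (h : Is3BiHomLieSuperalgebra K G br α β)
    (lam : K) (R : Module.End K V)
    (hRe : IsEvenMap K G R) (hRα : R * α = α * R) (hRβ : R * β = β * R)
    (hRB : IsRotaBaxter₃ K br lam R) (hidem : R * R = R) :
    IsNonMult3BiHomLieSuperalgebra K G
      (fun x y z => br (R x) (R y) z + br (R x) y (R z) + br x (R y) (R z)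
        + lam • br (R x) y z + lam • br x (R y) z + lam • br x y (R z)
        + lam ^ 2 • br x y z)
      (α * R) (β * R) := by
  change IsNonMult3BiHomLieSuperalgebra K G (twistedBracket br lam R) (α * R) (β * R)
  have hRR (x : V) : R (R x) = R x := LinearMap.congr_fun hidem x
  have hα (x : V) : R (α x) = α (R x) := LinearMap.congr_fun hRα x
  have hβ (x : V) : R (β x) = β (R x) := LinearMap.congr_fun hRβ x
  have hαR (x : V) : R (α (R x)) = α (R x) := by rw [hα, hRR]
  have hβR (x : V) : R (β (R x)) = β (R x) := by rw [hβ, hRR]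
  have hββR (x : V) : R (β (β (R x))) = β (β (R x)) := by rw [hβ, hβR]
  refine ⟨h.internal, h.trilinear.twistedBracket,
    fun _ _ _ _ hx _ hy _ hz => twistedBracket_mem hRe h.br_even hx hy hz,
    fun i x hx => h.alpha_even i _ (hRe i x hx), fun i x hx => h.beta_even i _ (hRe i x hx),
    ?_, ?_, ?_⟩
  · intro i j k x hx y hy z hz
    simp only [Module.End.mul_apply]
    rw [twistedBracket_of_fixed (hβR _) (hβR _) (hαR _),
      twistedBracket_of_fixed (hβR _) (hβR _) (hαR _),
      h.skew₁ i j k _ (hRe i x hx) _ (hRe j y hy) _ (hRe k z hz), smul_comm]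
  · intro i j k x hx y hy z hz
    simp only [Module.End.mul_apply]
    rw [twistedBracket_of_fixed (hβR _) (hβR _) (hαR _),
      twistedBracket_of_fixed (hβR _) (hβR _) (hαR _),
      h.skew₂ i j k _ (hRe i x hx) _ (hRe j y hy) _ (hRe k z hz), smul_comm]
  · intro i j k l m x hx y hy z hz u hu v hv
    have key (p q a b c : V) :=
      twistedBracket_twistedBracket_of_fixed h.trilinear hRB (hββR p) (hββR q) (hβR a) (hβR b)
        (hαR c)
    simp only [Module.End.mul_apply, hβR, key]
    rw [h.jacobi i j k l m _ (hRe i x hx) _ (hRe j y hy) _ (hRe k z hz) _ (hRe l u hu)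
      _ (hRe m v hv)]
    module

end BiHomLieSuper
end

section
/- Let (g, [·,·], α, β) be a BiHom-Lie superalgebra over a field K, let N be a Nijenhuis operator on (g, [·,·], α, β), and let τ : g → K be an even linear form satisfying τ([x,y]) = 0, τ(x)τ(β(y)) = τ(y)τ(β(x)), and τ(α(x))β(y) = τ(β(x))α(y) for all x, y. Then N is a Nijenhuis operator on the induced 3-BiHom-Lie superalgebra (g, [·,·,·]_τ, α, β), i.e. for all homogeneous x₁,x₂,x₃: [N(x₁),N(x₂),N(x₃)]_τ = N([N(x₁),N(x₂),x₃]_τ + [N(x₁),x₂,N(x₃)]_τ + [x₁,N(x₂),N(x₃)]_τ) - N²([N(x₁),x₂,x₃]_τ + [x₁,N(x₂),x₃]_τ + [x₁,x₂,N(x₃)]_τ) + N³([x₁,x₂,x₃]_τ). -/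
namespace BiHomLieSuper

variable (K : Type*) {V : Type*} [Field K] [AddCommGroup V] [Module K V]

/-- A Nijenhuis operator `N` on a BiHom-Lie superalgebra is a Nijenhuis
operator on the induced 3-BiHom-Lie superalgebra `(g, [·,·,·]_τ, α, β)`. -/
theorem nijenhuis_induced {K V : Type*} [Field K] [AddCommGroup V] [Module K V]
    (G : ZMod 2 → Submodule K V)
    (br : V → V → V) (α β : Module.End K V)
    (h : IsBiHomLieSuperalgebra K G br α β)
    (N : Module.End K V) (hNe : IsEvenMap K G N)
    (hNα : N * α = α * N) (hNβ : N * β = β * N)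
    (hN : IsNijenhuis₂ K br N)
    (τ : V →ₗ[K] K) (hτ : TauCompatible K G br α β τ)
    (brτ : V → V → V → V) (hind : IsInducedBracket K G br τ brτ) :
    ∀ (i j k : ZMod 2), ∀ x₁ ∈ G i, ∀ x₂ ∈ G j, ∀ x₃ ∈ G k,
      brτ (N x₁) (N x₂) (N x₃)
        = N (brτ (N x₁) (N x₂) x₃ + brτ (N x₁) x₂ (N x₃) + brτ x₁ (N x₂) (N x₃))
          - N (N (brτ (N x₁) x₂ x₃ + brτ x₁ (N x₂) x₃ + brτ x₁ x₂ (N x₃)))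
          + N (N (N (brτ x₁ x₂ x₃))) := by
  intro i j k x₁ h₁ x₂ h₂ x₃ h₃
  have h₁' := hNe i x₁ h₁
  have h₂' := hNe j x₂ h₂
  have h₃' := hNe k x₃ h₃
  rw [hind.2 i j k _ h₁' _ h₂' _ h₃', hind.2 i j k _ h₁' _ h₂' _ h₃,
    hind.2 i j k _ h₁' _ h₂ _ h₃', hind.2 i j k _ h₁ _ h₂' _ h₃',
    hind.2 i j k _ h₁' _ h₂ _ h₃, hind.2 i j k _ h₁ _ h₂' _ h₃,
    hind.2 i j k _ h₁ _ h₂ _ h₃', hind.2 i j k _ h₁ _ h₂ _ h₃,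
    hN x₁ x₂, hN x₁ x₃, hN x₂ x₃]
  simp only [map_add, map_sub, map_smul]
  module

end BiHomLieSuper
end

section
/- Let (g, [·,·,·], α, β) be a 3-BiHom-Lie superalgebra over a field K, let N be a Nijenhuis operator on g, and let R be a Rota-Baxter operator of weight λ on g such that R∘N = N∘R. Then N is a Nijenhuis operator on the 3-BiHom-Lie superalgebra (g, [·,·,·]_R, α, β), where [x₁,x₂,x₃]_R = [R(x₁),R(x₂),x₃] + [R(x₁),x₂,R(x₃)] + [x₁,R(x₂),R(x₃)] + λ[R(x₁),x₂,x₃] + λ[x₁,R(x₂),x₃] + λ[x₁,x₂,R(x₃)] + λ²[x₁,x₂,x₃]. -/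
namespace BiHomLieSuper

variable (K : Type*) {V : Type*} [Field K] [AddCommGroup V] [Module K V]

/-- A Nijenhuis operator `N` on a 3-BiHom-Lie superalgebra commuting with a
Rota-Baxter operator `R` of weight `lam` is a Nijenhuis operator on
`(g, [·,·,·]_R, α, β)`. -/
theorem nijenhuis_on_rotaBaxter_bracket {K V : Type*} [Field K] [AddCommGroup V] [Module K V]
    (G : ZMod 2 → Submodule K V)
    (br : V → V → V → V) (α β : Module.End K V)
    (h : Is3BiHomLieSuperalgebra K G br α β)
    (N : Module.End K V) (hNe : IsEvenMap K G N)
    (hNα : N * α = α * N) (hNβ : N * β = β * N)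
    (hN : IsNijenhuis₃ K br N)
    (lam : K) (R : Module.End K V)
    (hRe : IsEvenMap K G R) (hRα : R * α = α * R) (hRβ : R * β = β * R)
    (hRB : IsRotaBaxter₃ K br lam R)
    (hcomm : R * N = N * R) :
    IsNijenhuis₃ K
      (fun x y z => br (R x) (R y) z + br (R x) y (R z) + br x (R y) (R z)
        + lam • br (R x) y z + lam • br x (R y) z + lam • br x y (R z)
        + lam ^ 2 • br x y z)
      N := by
  have hRN : ∀ v, R (N v) = N (R v) := LinearMap.congr_fun hcomm
  unfold IsNijenhuis₃ at hN ⊢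
  intro x y z
  simp only [hRN, hN, map_add, map_smul]
  module

end BiHomLieSuper
end
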